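/- arXiv:2309.14947 — 3 statements merged into one kernel-verified Lean document; each statement's English description precedes it below -/
import Mathlib

section
/- Let n ≥ 1 be an integer and let m₁, m₂, m₃, m₄ be nonnegative integers satisfying m₁ + m₂ + m₃ + m₄ = 2(n−1), m₃ + m₄ < n−1, m₁ ≤ n−1, and m₂ + m₄ ≤ n−1. Then ∑_{k=0}^{n−1−m₂−m₄} C(n−2−m₃−m₄+k, n−2−m₃−m₄) · C(m₃−k, n−1−m₁) = C(n−1−m₄, m₂), where C(·,·) denotes the binomial coefficient. (Under the stated hypotheses all the arguments n−2−m₃−m₄, m₃−k for 0 ≤ k ≤ n−1−m₂−m₄, n−1−m₁, and n−1−m₄ are nonnegative.) -/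
/-- The Chu–Vandermonde identity for binomial coefficients with fixed lower indices. -/
theorem Nat.sum_range_choose_add_mul_choose_add (a b s : ℕ) :
    ∑ k ∈ Finset.range (s + 1), (a + k).choose a * (b + (s - k)).choose b
      = (a + b + s + 1).choose (a + b + 1) := by
  induction b generalizing s with
  | zero =>
    simpa [Nat.add_comm, Nat.add_left_comm] using Nat.sum_range_add_choose s a
  | succ b ihb =>
    induction s with
    | zero => simp
    | succ s ihs =>
      have pascal : ∀ k ∈ Finset.range (s + 1),
          (a + k).choose a * (b + 1 + (s + 1 - k)).choose (b + 1)
            = (a + k).choose a * (b + (s + 1 - k)).choose b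
              + (a + k).choose a * (b + 1 + (s - k)).choose (b + 1) := by
        intro k hk
        have hks : k ≤ s := Finset.mem_range_succ_iff.mp hk
        rw [← mul_add, show b + 1 + (s + 1 - k) = b + (s + 1 - k) + 1 by omega,
          Nat.choose_succ_succ, show b + 1 + (s - k) = b + (s + 1 - k) by omega]
      have hb := ihb (s + 1)
      rw [Finset.sum_range_succ] at hb ⊢
      rw [Finset.sum_congr rfl pascal, Finset.sum_add_distrib, ihs,
        show a + (b + 1) + (s + 1) + 1 = a + b + (s + 1) + 1 + 1 by omega,
        show a + (b + 1) + 1 = a + b + 1 + 1 by omega,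
        Nat.choose_succ_succ (a + b + (s + 1) + 1), ← hb,
        show a + (b + 1) + s + 1 = a + b + (s + 1) + 1 by omega]
      simp only [Nat.sub_self, Nat.add_zero, Nat.choose_self, Nat.succ_eq_add_one]
      omega

/-- The key combinatorial identity in the computation of tropical Tevelev degrees of
Hirzebruch surfaces: the number of type-A plus type-B tropical curves equals
`C(n-1-m₄, m₂)`. -/
theorem tevelev_binomial_identity
    (n m₁ m₂ m₃ m₄ : ℕ) (hn : 1 ≤ n)
    (hsum : m₁ + m₂ + m₃ + m₄ = 2 * (n - 1))
    (h34 : m₃ + m₄ < n - 1)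
    (h1 : m₁ ≤ n - 1)
    (h24 : m₂ + m₄ ≤ n - 1) :
    ∑ k ∈ Finset.range (n - 1 - m₂ - m₄ + 1),
        Nat.choose (n - 2 - m₃ - m₄ + k) (n - 2 - m₃ - m₄) *
          Nat.choose (m₃ - k) (n - 1 - m₁)
      = Nat.choose (n - 1 - m₄) m₂ := by
  have key := Nat.sum_range_choose_add_mul_choose_add
    (n - 2 - m₃ - m₄) (n - 1 - m₁) (n - 1 - m₂ - m₄)
  rw [show n - 2 - m₃ - m₄ + (n - 1 - m₁) + (n - 1 - m₂ - m₄) + 1 = n - 1 - m₄ by omega,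
    show n - 2 - m₃ - m₄ + (n - 1 - m₁) + 1 = m₂ by omega] at key
  rw [← key]
  refine Finset.sum_congr rfl fun k hk => ?_
  have hk' := Finset.mem_range_succ_iff.mp hk
  rw [show m₃ - k = n - 1 - m₁ + (n - 1 - m₂ - m₄ - k) by omega]
end

section
/- Let K be a field and let a, j be natural numbers with 1 ≤ j and 2j ≤ a. Let l₀, l₁, t₀, t₁, s ∈ K with (l₀, l₁) ≠ (0, 0), (t₀, t₁) ≠ (0, 0), and s ≠ 0. Set y₀ = s·l₀^j·t₀, y₁ = s·l₁^{j+1}·t₁, and y₂ = l₁^{a−j−1}·t₀ − l₀^{a−j}·t₁. Then (y₀, y₁, y₂) ≠ (0, 0, 0), and moreover l₀^a·y₁ − l₁^a·y₀ + s·l₀^j·l₁^{j+1}·y₂ = 0. -/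
/-- Well-definedness of the isomorphism
`𝓗_{a-2j} × (𝔸¹ ∖ {0}) → 𝓤 ∖ π⁻¹(0)`: the image point has not-all-zero `ℙ²`-coordinates
and satisfies the defining equation of the family `𝓤`. -/
theorem family_iso_well_defined
    {K : Type*} [Field K] (a j : ℕ) (hj : 1 ≤ j) (hja : 2 * j ≤ a)
    (l₀ l₁ t₀ t₁ s : K)
    (hl : ¬(l₀ = 0 ∧ l₁ = 0)) (ht : ¬(t₀ = 0 ∧ t₁ = 0)) (hs : s ≠ 0)
    (y₀ y₁ y₂ : K)
    (hy₀ : y₀ = s * l₀ ^ j * t₀)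
    (hy₁ : y₁ = s * l₁ ^ (j + 1) * t₁)
    (hy₂ : y₂ = l₁ ^ (a - j - 1) * t₀ - l₀ ^ (a - j) * t₁) :
    ¬(y₀ = 0 ∧ y₁ = 0 ∧ y₂ = 0) ∧
    l₀ ^ a * y₁ - l₁ ^ a * y₀ + s * l₀ ^ j * l₁ ^ (j + 1) * y₂ = 0 := by
  obtain ⟨m, rfl⟩ : ∃ m, a = j + 1 + m := ⟨a - (j + 1), by lia⟩
  rw [show j + 1 + m - j - 1 = m by lia, show j + 1 + m - j = m + 1 by lia] at hy₂
  subst hy₀ hy₁ hy₂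
  refine ⟨?_, by ring⟩
  rintro ⟨h₀, h₁, h₂⟩
  by_cases hl₀ : l₀ = 0
  · have hl₁ : l₁ ≠ 0 := fun h => hl ⟨hl₀, h⟩
    have ht₁ : t₁ = 0 := by simpa [hs, hl₁] using h₁
    have ht₀ : t₀ = 0 := by simpa [ht₁, hl₁] using h₂
    exact ht ⟨ht₀, ht₁⟩
  · have ht₀ : t₀ = 0 := by simpa [hs, hl₀] using h₀
    have ht₁ : t₁ = 0 := by simpa [ht₀, hl₀] using h₂
    exact ht ⟨ht₀, ht₁⟩
end

section
/- Let n ≥ 1. There is no ℂ-linear subspace W of (ℂ²)^n with dim_ℂ W ≤ n having the following property: for every n-tuple (x₁, …, x_n) of nonzero vectors xᵢ ∈ ℂ² there exist a vector w = (w₁, …, w_n) ∈ W and nonzero scalars c₁, …, c_n ∈ ℂ with wᵢ = cᵢ·xᵢ for all i. Equivalently, any subspace W ⊆ (ℂ²)^n with this interpolation property has dimension at least n + 1. -/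
open Cardinal in
/-- The complex numbers have infinite transcendence degree over every countable subring. -/
theorem exists_algebraicIndependent_fin_of_mk_le_aleph0 (R : Subalgebra ℤ ℂ)
    (hR : #R ≤ ℵ₀) (n : ℕ) : ∃ z : Fin n → ℂ, AlgebraicIndependent R z := by
  obtain ⟨s, hs⟩ := exists_isTranscendenceBasis R ℂ
  have hcard := IsAlgClosed.cardinal_eq_cardinal_transcendence_basis_of_aleph0_lt' _ hs hR
    (by rw [Cardinal.mk_complex]; exact Cardinal.aleph0_lt_continuum)
  have hle : #(Fin n) ≤ #s := by
    rw [← hcard, Cardinal.mk_complex, Cardinal.mk_fin]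
    exact (Cardinal.nat_lt_continuum n).le
  obtain ⟨f⟩ := Cardinal.le_def _ _ |>.mp hle
  exact ⟨_, hs.1.comp f f.injective⟩

/-- Quotients of homogeneous linear forms in `d` variables generate an extension of
transcendence degree less than `d`. -/
theorem card_lt_of_algebraicIndependent_of_linearForms {R F ι κ : Type*} [CommRing R] [Field F]
    [Algebra R F] [Fintype ι] [Fintype κ] (a b : ι → κ → R) (t : κ → F) (z : ι → F)
    (hz : AlgebraicIndependent R z) (ht : t ≠ 0)
    (ha : ∀ i, ∑ j, algebraMap R F (a i j) * t j ≠ 0)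
    (hab : ∀ i, ∑ j, algebraMap R F (b i j) * t j =
      (∑ j, algebraMap R F (a i j) * t j) * z i) :
    Fintype.card ι < Fintype.card κ := by
  classical
  obtain ⟨k, hk⟩ := Function.ne_iff.mp ht
  have hk : t k ≠ 0 := hk
  have : FaithfulSMul R F :=
    (faithfulSMul_iff_algebraMap_injective R F).mpr hz.algebraMap_injective
  have : IsDomain R := hz.algebraMap_injective.isDomain (algebraMap R F)
  let u : κ → F := fun j ↦ t j / t k
  let s : Finset F := (Finset.univ.erase k).image u
  have hu (j : κ) : u j ∈ Algebra.adjoin R (s : Set F) := by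
    by_cases hj : j = k
    · simp [u, hj, hk]
    · exact Algebra.subset_adjoin (by simpa [s] using ⟨j, hj, rfl⟩)
  have hform (c : κ → R) : ∑ j, algebraMap R F (c j) * u j ∈ Algebra.adjoin R (s : Set F) :=
    sum_mem fun j _ ↦ mul_mem (Subalgebra.algebraMap_mem _ _) (hu j)
  have hscale (c : κ → R) :
      ∑ j, algebraMap R F (c j) * u j = (∑ j, algebraMap R F (c j) * t j) / t k := by
    rw [Finset.sum_div]
    exact Finset.sum_congr rfl fun j _ ↦ by simp [u, mul_div_assoc]
  have hzs (i : ι) : IsAlgebraic (Algebra.adjoin R (s : Set F)) (z i) := by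
    have hzi : z i =
        (∑ j, algebraMap R F (b i j) * u j) * (∑ j, algebraMap R F (a i j) * u j)⁻¹ := by
      have := ha i
      rw [hscale, hscale, hab]
      field_simp
    rw [hzi]
    exact (isAlgebraic_algebraMap (⟨_, hform (b i)⟩ : Algebra.adjoin R (s : Set F))).mul
      (isAlgebraic_algebraMap (⟨_, hform (a i)⟩ : Algebra.adjoin R (s : Set F))).inv
  let M := AlgebraicIndependent.matroid R F
  have hind : M.Indep (Set.range z) :=
    AlgebraicIndependent.matroid_indep_iff.mpr hz.to_subtype_range
  have hsub : Set.range z ⊆ M.closure s := by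
    rintro _ ⟨i, rfl⟩
    rw [AlgebraicIndependent.matroid_closure_eq]
    exact hzs i
  have hle : (Set.range z).encard ≤ (s : Set F).encard :=
    (hind.encard_le_eRk_of_subset hsub).trans
      ((M.eRk_closure_eq _).trans_le (M.eRk_le_encard _))
  rw [← Set.image_univ, hz.injective.encard_image, Set.encard_univ, ENat.card_eq_coe_fintype_card,
    Set.encard_coe_eq_coe_finsetCard, Nat.cast_le] at hle
  calc Fintype.card ι ≤ s.card := hle
    _ ≤ (Finset.univ.erase k).card := Finset.card_image_le
    _ < Fintype.card κ := Finset.card_erase_lt_of_mem (Finset.mem_univ k)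

/-- Any `ℂ`-linear subspace `W ⊆ (ℂ²)ⁿ` such that every `n`-tuple of nonzero vectors of
`ℂ²` can be matched, up to nonzero scalars in each coordinate, by a vector of `W`, must
have dimension at least `n + 1`. -/
theorem interpolation_subspace_dim_ge
    (n : ℕ) (hn : 1 ≤ n) (W : Submodule ℂ (Fin n → ℂ × ℂ))
    (hW : ∀ x : Fin n → ℂ × ℂ, (∀ i, x i ≠ 0) →
      ∃ w ∈ W, ∃ c : Fin n → ℂ, (∀ i, c i ≠ 0) ∧ ∀ i, w i = c i • x i) :
    ¬ Module.finrank ℂ W ≤ n := by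
  rw [not_le]
  let β := Module.finBasis ℂ W
  let S : Set ℂ := Set.range (fun p : Fin n × Fin (Module.finrank ℂ W) ↦
      ((β p.2 : Fin n → ℂ × ℂ) p.1).1) ∪
    Set.range (fun p : Fin n × Fin (Module.finrank ℂ W) ↦
      ((β p.2 : Fin n → ℂ × ℂ) p.1).2)
  let R := Algebra.adjoin ℤ S
  have hR : Cardinal.mk R ≤ Cardinal.aleph0 :=
    (Algebra.cardinalMk_adjoin_le ℤ S).trans (by simp [S])
  obtain ⟨z, hz⟩ := exists_algebraicIndependent_fin_of_mk_le_aleph0 R hR n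
  obtain ⟨w, hwW, c, hc, hw⟩ := hW (fun i ↦ (1, z i)) (by simp)
  let t := β.repr ⟨w, hwW⟩
  have hsum : w = ∑ j, t j • (β j : Fin n → ℂ × ℂ) := by
    have := congrArg W.subtype (β.sum_repr ⟨w, hwW⟩)
    rw [map_sum] at this
    exact this.symm
  have hfst (i : Fin n) : ∑ j, ((β j : Fin n → ℂ × ℂ) i).1 * t j = c i := by
    have := congrArg Prod.fst ((congrFun hsum i).symm.trans (hw i))
    simpa [Finset.sum_apply, Prod.fst_sum, mul_comm] using this
  have hsnd (i : Fin n) : ∑ j, ((β j : Fin n → ℂ × ℂ) i).2 * t j = c i * z i := by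
    have := congrArg Prod.snd ((congrFun hsum i).symm.trans (hw i))
    simpa [Finset.sum_apply, Prod.snd_sum, mul_comm] using this
  have ht : (t : Fin (Module.finrank ℂ W) → ℂ) ≠ 0 := fun h ↦
    hc ⟨0, hn⟩ (by rw [← hfst]; simp [h])
  have hlt := card_lt_of_algebraicIndependent_of_linearForms (R := R)
    (fun i j ↦ ⟨((β j : Fin n → ℂ × ℂ) i).1, Algebra.subset_adjoin (.inl ⟨(i, j), rfl⟩)⟩)
    (fun i j ↦ ⟨((β j : Fin n → ℂ × ℂ) i).2, Algebra.subset_adjoin (.inr ⟨(i, j), rfl⟩)⟩)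
    t z hz ht (fun i ↦ (hfst i).trans_ne (hc i))
    (fun i ↦ (hsnd i).trans (congrArg (· * z i) (hfst i).symm))
  simpa using hlt
end
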